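/- Let H ∈ (0,1) with H ≠ 1/2, let β ≥ 0 and γ > 0, and define G(s,t) = β²(t−s) + γ²[−2^{2H−1}(s^{2H} + t^{2H}) + (s+t)^{2H} + (t−s)^{2H}] for 0 ≤ s ≤ t (the increment variance E[(M_t^{β,γ,H} − M_s^{β,γ,H})²] of a mixed sub-fractional Brownian motion). Then for all 0 ≤ s < t and all u > 0 one has G(s+u, t+u) ≠ G(s,t); that is, the increments of the mixed sub-fractional Brownian motion are non-stationary. -/

import Mathlib

/-- The increment variance `E[(M_t^{β,γ,H} − M_s^{β,γ,H})²]` of a mixed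
sub-fractional Brownian motion. -/
noncomputable def msfBmIncVar (H β γ s t : ℝ) : ℝ :=
  β ^ 2 * (t - s)
    + γ ^ 2 * (-(2 : ℝ) ^ (2 * H - 1) * (s ^ (2 * H) + t ^ (2 * H))
      + (s + t) ^ (2 * H) + (t - s) ^ (2 * H))

/-- For a negative exponent `p`, `fun x ↦ x ^ p` is strictly convex on `(0, +∞)`. -/
theorem strictConvexOn_rpow_of_neg {p : ℝ} (hp : p < 0) :
    StrictConvexOn ℝ (Set.Ioi 0) fun x : ℝ => x ^ p := by
  refine StrictMonoOn.strictConvexOn_of_deriv (convex_Ioi 0)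
    (fun x hx => (Real.continuousAt_rpow_const x p (Or.inl (ne_of_gt hx))).continuousWithinAt) ?_
  rw [interior_Ioi]
  intro x hx y hy hxy
  rw [Real.deriv_rpow_const, Real.deriv_rpow_const]
  exact mul_lt_mul_of_neg_left (Real.rpow_lt_rpow_of_neg hx hxy (by linarith)) hp

theorem hasDerivAt_rpow_secondDifference {a s t u : ℝ} (hs : 0 ≤ s) (hst : s < t) (hu : 0 < u) :
    HasDerivAt (fun x : ℝ => (s + x) ^ a + (t + x) ^ a - 2 * ((s + t) / 2 + x) ^ a)
      (a * ((s + u) ^ (a - 1) + (t + u) ^ (a - 1) - 2 * ((s + t) / 2 + u) ^ (a - 1))) u := by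
  have key (c : ℝ) (hc : 0 ≤ c) :
      HasDerivAt (fun x : ℝ => (c + x) ^ a) (a * (c + u) ^ (a - 1)) u := by
    have h := ((hasDerivAt_id u).const_add c).rpow_const (p := a)
      (Or.inl (show c + id u ≠ 0 by simp only [id]; positivity))
    simpa using h
  exact (((key s hs).add (key t (by linarith))).sub
    ((key ((s + t) / 2) (by linarith)).const_mul 2)).congr_deriv (by ring)

theorem continuousOn_rpow_secondDifference {a : ℝ} (ha : 0 < a) (s t : ℝ) :
    ContinuousOn (fun x : ℝ => (s + x) ^ a + (t + x) ^ a - 2 * ((s + t) / 2 + x) ^ a)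
      (Set.Ici 0) := by
  have key (c : ℝ) : Continuous (fun x : ℝ => (c + x) ^ a) :=
    (continuous_const.add continuous_id).rpow_const fun _ => Or.inr ha.le
  exact (((key s).add (key t)).sub ((key _).const_mul 2)).continuousOn

/-- For an exponent in `(1, 2)`, the symmetric second difference of a power strictly decreases
under translation. -/
theorem strictAntiOn_rpow_secondDifference {a s t : ℝ} (ha : 1 < a) (ha' : a < 2)
    (hs : 0 ≤ s) (hst : s < t) :
    StrictAntiOn (fun x : ℝ => (s + x) ^ a + (t + x) ^ a - 2 * ((s + t) / 2 + x) ^ a)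
      (Set.Ici 0) := by
  refine strictAntiOn_of_deriv_neg (convex_Ici 0)
    (continuousOn_rpow_secondDifference (by linarith) s t) fun u hu => ?_
  rw [interior_Ici] at hu
  have hu : 0 < u := hu
  rw [(hasDerivAt_rpow_secondDifference hs hst hu).deriv]
  have h := (Real.strictConcaveOn_rpow (p := a - 1) (by linarith) (by linarith)).2
    (show 0 ≤ s + u by linarith) (show 0 ≤ t + u by linarith) (by linarith)
    (one_half_pos (α := ℝ)) (one_half_pos (α := ℝ)) (by norm_num)
  simp only [smul_eq_mul] at h
  rw [show 1 / 2 * (s + u) + 1 / 2 * (t + u) = (s + t) / 2 + u by ring] at h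
  exact mul_neg_of_pos_of_neg (by linarith) (by linarith)

/-- For an exponent in `(0, 1)`, the symmetric second difference of a power strictly increases
under translation. -/
theorem strictMonoOn_rpow_secondDifference {a s t : ℝ} (ha : 0 < a) (ha' : a < 1)
    (hs : 0 ≤ s) (hst : s < t) :
    StrictMonoOn (fun x : ℝ => (s + x) ^ a + (t + x) ^ a - 2 * ((s + t) / 2 + x) ^ a)
      (Set.Ici 0) := by
  refine strictMonoOn_of_deriv_pos (convex_Ici 0)
    (continuousOn_rpow_secondDifference ha s t) fun u hu => ?_
  rw [interior_Ici] at hu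
  have hu : 0 < u := hu
  rw [(hasDerivAt_rpow_secondDifference hs hst hu).deriv]
  have h := (strictConvexOn_rpow_of_neg (p := a - 1) (by linarith)).2
    (show 0 < s + u by linarith) (show 0 < t + u by linarith) (by linarith)
    (one_half_pos (α := ℝ)) (one_half_pos (α := ℝ)) (by norm_num)
  simp only [smul_eq_mul] at h
  rw [show 1 / 2 * (s + u) + 1 / 2 * (t + u) = (s + t) / 2 + u by ring] at h
  exact mul_pos ha (by linarith)

theorem msfBmIncVar_add_add {H s t : ℝ} (β γ u : ℝ) (hs : 0 ≤ s) (hst : s < t) (hu : 0 ≤ u) :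
    msfBmIncVar H β γ (s + u) (t + u) =
      β ^ 2 * (t - s) + γ ^ 2 * (t - s) ^ (2 * H) - γ ^ 2 * 2 ^ (2 * H - 1) *
        ((s + u) ^ (2 * H) + (t + u) ^ (2 * H) - 2 * ((s + t) / 2 + u) ^ (2 * H)) := by
  have h : (s + u + (t + u)) ^ (2 * H) =
      2 ^ (2 * H - 1) * (2 * ((s + t) / 2 + u) ^ (2 * H)) := by
    rw [show s + u + (t + u) = 2 * ((s + t) / 2 + u) by ring,
      Real.mul_rpow (by norm_num) (by linarith), Real.rpow_sub_one (by norm_num)]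
    ring
  rw [msfBmIncVar, h, show t + u - (s + u) = t - s by ring]
  ring

/-- For `H ≠ 1/2` and `γ > 0`, the increments of the mixed sub-fractional Brownian
motion are non-stationary. -/
theorem msfBm_increments_nonstationary
    (H β γ : ℝ) (hH : H ∈ Set.Ioo (0 : ℝ) 1) (hH' : H ≠ 1 / 2)
    (hβ : 0 ≤ β) (hγ : 0 < γ) :
    ∀ s t u : ℝ, 0 ≤ s → s < t → 0 < u →
      msfBmIncVar H β γ (s + u) (t + u) ≠ msfBmIncVar H β γ s t := by
  intro s t u hs hst hu heq
  obtain ⟨h0, h1⟩ := hH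
  have heq0 := msfBmIncVar_add_add (H := H) β γ 0 hs hst le_rfl
  rw [add_zero s, add_zero t, ← heq, msfBmIncVar_add_add β γ u hs hst hu.le] at heq0
  have hc : γ ^ 2 * (2 : ℝ) ^ (2 * H - 1) ≠ 0 := by positivity
  have hψ := mul_left_cancel₀ hc (sub_right_injective heq0)
  have hu' : u ∈ Set.Ici (0 : ℝ) := hu.le
  rcases lt_or_gt_of_ne hH' with h | h
  · have := strictMonoOn_rpow_secondDifference (a := 2 * H) (by linarith) (by linarith) hs hst
      Set.self_mem_Ici hu' hu
    simp only [add_zero] at this hψ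
    linarith
  · have := strictAntiOn_rpow_secondDifference (a := 2 * H) (by linarith) (by linarith) hs hst
      Set.self_mem_Ici hu' hu
    simp only [add_zero] at this hψ
    linarith
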